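/- Let 𝕀 = (I, ≤, 𝓘) be a set of indices, let 𝓑, 𝒵 be asymptotic gauges on 𝕀, and let Ω ⊆ ℝⁿ be a nonempty open set. Assume that for every b ∈ 𝓑 and every z ∈ 𝒵, either b = O(z) or z = O(b). If 𝒩(𝒵,Ω) is a multiplicative ideal of ℰ_M(𝓑,Ω) (i.e. for every u ∈ 𝒩(𝒵,Ω) and v ∈ ℰ_M(𝓑,Ω) the product net (u_ε·v_ε)_ε belongs to 𝒩(𝒵,Ω)), then ℝ_M(𝓑) ⊆ ℝ_M(𝒵). -/

import Mathlib

open MeasureTheory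

/-- Strict order relation used in the paper: `x < y` iff `x ≤ y` and `x ≠ y`. -/
def sLT {I : Type*} [Preorder I] (x y : I) : Prop := x ≤ y ∧ x ≠ y

/-- A set of indices `𝕀 = (I, ≤, 𝓘)` in the sense of Giordano–Luperi Baglini. -/
structure SetOfIndices (I : Type*) [Preorder I] where
  sets : Set (Set I)
  empty_not_mem : (∅ : Set I) ∉ sets
  univ_mem : (Set.univ : Set I) ∈ sets
  inter_sub : ∀ A ∈ sets, ∀ B ∈ sets, ∃ C ∈ sets, C ⊆ A ∩ B
  downward : ∀ A ∈ sets, ∀ a ∈ A, ∀ e, e ≤ a →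
    ((∃ ε, ε ∈ A ∧ ε ≤ e) ∧
      (∀ b ∈ A, b ≤ e → ∀ c ∈ A, c ≤ e →
        ∃ d, d ∈ A ∧ d ≤ e ∧ sLT d b ∧ sLT d c))

section Defs

variable {I : Type*} [Preorder I]

/-- `x = O_{a,A}(y)`. -/
def BigOaA (A : Set I) (a : I) (x y : I → ℝ) : Prop :=
  ∃ H : ℝ, 0 < H ∧ ∃ ε₀, ε₀ ∈ A ∧ ε₀ ≤ a ∧ ∀ ε ∈ A, ε ≤ ε₀ → |x ε| ≤ H * |y ε|

/-- `x = O_𝒥(y)` for a family `𝒥` of subsets of `I`. -/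
def BigOJ (J : Set (Set I)) (x y : I → ℝ) : Prop :=
  ∃ A ∈ J, ∀ a ∈ A, BigOaA A a x y

/-- `x = O(y)` (i.e. `O_𝓘`). -/
def BigO (S : SetOfIndices I) (x y : I → ℝ) : Prop := BigOJ S.sets x y

/-- `i >_𝕀 j`. -/
def gtI (S : SetOfIndices I) (i j : I → ℝ) : Prop :=
  ∃ A ∈ S.sets, ∀ a ∈ A, ∃ e, e ∈ A ∧ e ≤ a ∧ ∀ ε ∈ A, ε ≤ e → j ε < i ε

/-- `P(ε)` holds for `ε` sufficiently small in `𝕀`. -/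
def EventuallyI (S : SetOfIndices I) (P : I → Prop) : Prop :=
  ∃ A ∈ S.sets, ∀ a ∈ A, ∃ e, e ∈ A ∧ e ≤ a ∧ ∀ ε ∈ A, ε ≤ e → P ε

/-- `lim_𝕀 f = l` for a finite limit `l ∈ ℝ`. -/
def limEq (S : SetOfIndices I) (f : I → ℝ) (l : ℝ) : Prop :=
  ∃ A ∈ S.sets, ∀ a ∈ A, ∀ r : ℝ, 0 < r →
    ∃ a₀, a₀ ≤ a ∧ ∀ ε ∈ A, ε ≤ a₀ → |l - f ε| < r

/-- `lim_𝕀 f = ∞` (unsigned infinity). -/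
def limInfinite (S : SetOfIndices I) (f : I → ℝ) : Prop :=
  ∃ A ∈ S.sets, ∀ a ∈ A, ∀ R : ℝ, 0 < R →
    ∃ a₀, a₀ ≤ a ∧ ∀ ε ∈ A, ε ≤ a₀ → R < |f ε|

/-- `lim_𝕀 f = +∞`. -/
def limPInf (S : SetOfIndices I) (f : I → ℝ) : Prop :=
  ∃ A ∈ S.sets, ∀ a ∈ A, ∀ R : ℝ, 0 < R →
    ∃ a₀, a₀ ≤ a ∧ ∀ ε ∈ A, ε ≤ a₀ → R < f ε

/-- `𝓑` is an asymptotic gauge on the set of indices `S`. -/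
structure IsAG (S : SetOfIndices I) (B : Set (I → ℝ)) : Prop where
  infinite : ∃ i ∈ B, limInfinite S i
  mul : ∀ i ∈ B, ∀ j ∈ B, ∃ p ∈ B, BigO S (fun ε => i ε * j ε) p
  smul : ∀ i ∈ B, ∀ r : ℝ, ∃ σ ∈ B, BigO S (fun ε => r * i ε) σ
  absAdd : ∀ i ∈ B, ∀ j ∈ B, ∃ s ∈ B, gtI S s (fun _ => 0) ∧
    BigO S (fun ε => |i ε| + |j ε|) s

/-- `𝓑_{>0}`, the positive part of `𝓑`. -/
def agPos (S : SetOfIndices I) (B : Set (I → ℝ)) : Set (I → ℝ) :=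
  {i ∈ B | gtI S i (fun _ => 0)}

/-- `ℝ_M(𝓑)`, the moderate nets generated by `𝓑`. -/
def RM (S : SetOfIndices I) (B : Set (I → ℝ)) : Set (I → ℝ) :=
  {x | ∃ b ∈ B, BigO S x b}

/-- `sup_{x ∈ K} |f x|`. -/
noncomputable def supAbsOn {X : Type*} (K : Set X) (f : X → ℝ) : ℝ :=
  sSup ((fun x => |f x|) '' K)

/-- Partial derivative of `f : ℝⁿ → ℝ` in the `i`-th coordinate direction. -/
noncomputable def pDeriv {n : ℕ} (i : Fin n) (f : (Fin n → ℝ) → ℝ) :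
    (Fin n → ℝ) → ℝ :=
  fun x => fderiv ℝ f x (Pi.single i 1)

/-- Iterated partial derivative `∂^α f` along a list of coordinate directions
(the list encodes the multi-index `α ∈ ℕⁿ`). -/
noncomputable def multiDeriv {n : ℕ} : List (Fin n) → ((Fin n → ℝ) → ℝ) → ((Fin n → ℝ) → ℝ)
  | [], f => f
  | i :: l, f => multiDeriv l (pDeriv i f)

/-- `ℰ_M(𝓑,Ω)`: the `𝓑`-moderate nets of smooth functions on `Ω ⊆ ℝⁿ`. -/
def EMod (S : SetOfIndices I) (B : Set (I → ℝ)) {n : ℕ} (Ω : Set (Fin n → ℝ))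
    (u : I → (Fin n → ℝ) → ℝ) : Prop :=
  ∀ K : Set (Fin n → ℝ), K ⊆ Ω → IsCompact K → ∀ l : List (Fin n),
    ∃ b ∈ B, BigO S (fun ε => supAbsOn K (multiDeriv l (u ε))) b

/-- `𝒩(𝒵,Ω)`: the `𝒵`-negligible nets of smooth functions on `Ω ⊆ ℝⁿ`. -/
def NNeg (S : SetOfIndices I) (Z : Set (I → ℝ)) {n : ℕ} (Ω : Set (Fin n → ℝ))
    (u : I → (Fin n → ℝ) → ℝ) : Prop :=
  ∀ K : Set (Fin n → ℝ), K ⊆ Ω → IsCompact K → ∀ l : List (Fin n),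
    ∀ z ∈ agPos S Z,
      BigO S (fun ε => supAbsOn K (multiDeriv l (u ε))) (fun ε => (z ε)⁻¹)

/-- One–dimensional version of `ℰ_M(𝓑,ℝ)`, using iterated derivatives. -/
def EM1 (S : SetOfIndices I) (B : Set (I → ℝ)) (u : I → ℝ → ℝ) : Prop :=
  ∀ K : Set ℝ, IsCompact K → ∀ k : ℕ,
    ∃ b ∈ B, BigO S (fun ε => supAbsOn K (iteratedDeriv k (u ε))) b

/-- One–dimensional version of `𝒩(𝒵,ℝ)`, using iterated derivatives. -/
def NEG1 (S : SetOfIndices I) (Z : Set (I → ℝ)) (u : I → ℝ → ℝ) : Prop :=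
  ∀ K : Set ℝ, IsCompact K → ∀ k : ℕ, ∀ z ∈ agPos S Z,
    BigO S (fun ε => supAbsOn K (iteratedDeriv k (u ε))) (fun ε => (z ε)⁻¹)

/-- `AG(b) = {b^m ∣ m ∈ ℕ}`, the principal asymptotic gauge generated by `b`. -/
def AGpow (b : I → ℝ) : Set (I → ℝ) := {g | ∃ m : ℕ, g = fun ε => (b ε) ^ m}

/-- `e^𝓑 = {e^{H·b} ∣ H > 0, b ∈ 𝓑}`, the exponential of the asymptotic gauge `𝓑`. -/
def expAG (B : Set (I → ℝ)) : Set (I → ℝ) :=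
  {g | ∃ H : ℝ, 0 < H ∧ ∃ b ∈ B, g = fun ε => Real.exp (H * b ε)}

end Defs

section Auxiliary

variable {I : Type*} [Preorder I] {S : SetOfIndices I}

/-- `P H ε` holds for `ε` sufficiently small in `𝕀`, where the constant `H > 0` may depend on the
base point. `BigO` is of this form, and `gtI` is with `H = 1`. -/
def EventuallyExistsConst (S : SetOfIndices I) (P : ℝ → I → Prop) : Prop :=
  ∃ A ∈ S.sets, ∀ a ∈ A, ∃ H : ℝ, 0 < H ∧ ∃ e, e ∈ A ∧ e ≤ a ∧ ∀ ε ∈ A, ε ≤ e → P H ε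

theorem gtI.eventuallyExistsConst {i j : I → ℝ} (h : gtI S i j) :
    EventuallyExistsConst S (fun H ε => H = 1 ∧ j ε < i ε) := by
  obtain ⟨A, hA, h⟩ := h
  refine ⟨A, hA, fun a ha => ?_⟩
  obtain ⟨e, he, hea, h⟩ := h a ha
  exact ⟨1, one_pos, e, he, hea, fun ε hε hεe => ⟨rfl, h ε hε hεe⟩⟩

theorem EventuallyExistsConst.of_forall {P : ℝ → I → Prop} {H : ℝ} (hH : 0 < H)
    (h : ∀ ε, P H ε) : EventuallyExistsConst S P :=
  ⟨Set.univ, S.univ_mem, fun a _ => ⟨H, hH, a, trivial, le_rfl, fun ε _ _ => h ε⟩⟩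

theorem EventuallyExistsConst.map_mul {P Q R : ℝ → I → Prop} (hP : EventuallyExistsConst S P)
    (hQ : EventuallyExistsConst S Q)
    (h : ∀ H K : ℝ, 0 < H → 0 < K → ∀ ε, P H ε → Q K ε → R (H * K) ε) :
    EventuallyExistsConst S R := by
  obtain ⟨A, hA, hP⟩ := hP
  obtain ⟨B, hB, hQ⟩ := hQ
  obtain ⟨C, hC, hCAB⟩ := S.inter_sub A hA B hB
  refine ⟨C, hC, fun c hc => ?_⟩
  obtain ⟨H, hH, e, -, hec, hPe⟩ := hP c (hCAB hc).1
  obtain ⟨c', hc', hc'e⟩ := (S.downward C hC c hc e hec).1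
  obtain ⟨K, hK, e', -, hec', hQe⟩ := hQ c' (hCAB hc').2
  obtain ⟨d, hd, hde'⟩ := (S.downward C hC c' hc' e' hec').1
  have hde : d ≤ e := hde'.trans (hec'.trans hc'e)
  exact ⟨H * K, mul_pos hH hK, d, hd, hde.trans hec, fun ε hε hεd =>
    h H K hH hK ε (hPe ε (hCAB hε).1 (hεd.trans hde)) (hQe ε (hCAB hε).2 (hεd.trans hde'))⟩

theorem BigO.trans {x y z : I → ℝ} (hxy : BigO S x y) (hyz : BigO S y z) : BigO S x z :=
  EventuallyExistsConst.map_mul hxy hyz fun H K hH _ ε hx hy => by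
    rw [mul_assoc]
    exact hx.trans (mul_le_mul_of_nonneg_left hy hH.le)

theorem BigO.of_abs_le {x y : I → ℝ} (h : ∀ ε, |x ε| ≤ |y ε|) : BigO S x y :=
  EventuallyExistsConst.of_forall one_pos fun ε => (h ε).trans_eq (one_mul _).symm

theorem BigO.of_abs_add_abs_self {x y : I → ℝ} (h : BigO S (fun ε => |x ε| + |x ε|) y) :
    BigO S x y :=
  BigO.trans (BigO.of_abs_le fun ε => by
    rw [abs_of_nonneg (a := |x ε| + |x ε|) (by positivity)]
    exact le_add_of_nonneg_left (abs_nonneg _)) h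

theorem BigO.inv {x y : I → ℝ} (h : BigO S x y) (hx : gtI S x (fun _ => 0)) :
    BigO S (fun ε => (y ε)⁻¹) (fun ε => (x ε)⁻¹) :=
  EventuallyExistsConst.map_mul h hx.eventuallyExistsConst
    fun H K hH hK ε hxy hx0 => by
    obtain ⟨rfl, hx0⟩ := hx0
    have hy : 0 < |y ε| := pos_of_mul_pos_right ((abs_pos.2 hx0.ne').trans_le hxy) hH.le
    rw [mul_one, abs_inv, abs_inv, ← div_eq_mul_inv, inv_eq_one_div,
      div_le_div_iff₀ hy (abs_pos.2 hx0.ne'), one_mul]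
    exact hxy

theorem limInfinite.not_bigO_one {i : I → ℝ} (hi : limInfinite S i) :
    ¬ BigO S i (fun _ => 1) := by
  rintro ⟨A, hA, hO⟩
  obtain ⟨B, hB, hi⟩ := hi
  obtain ⟨C, hC, hCAB⟩ := S.inter_sub A hA B hB
  obtain ⟨c, hc⟩ : C.Nonempty :=
    Set.nonempty_iff_ne_empty.2 fun h => S.empty_not_mem (h ▸ hC)
  obtain ⟨H, hH, e, -, hec, hle⟩ := hO c (hCAB hc).1
  obtain ⟨c', hc', hc'e⟩ := (S.downward C hC c hc e hec).1
  obtain ⟨a₀, ha₀, hlt⟩ := hi c' (hCAB hc').2 H hH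
  obtain ⟨d, hd, hda₀⟩ := (S.downward C hC c' hc' a₀ ha₀).1
  have h₁ := hle d (hCAB hd).1 (hda₀.trans (ha₀.trans hc'e))
  have h₂ := hlt d (hCAB hd).2 hda₀
  rw [abs_one, mul_one] at h₁
  exact h₂.not_ge h₁

theorem abs_supAbsOn_le {X : Type*} {K : Set X} {f : X → ℝ} {M : ℝ} (hM : 0 ≤ M)
    (h : ∀ x ∈ K, |f x| ≤ M) : |supAbsOn K f| ≤ M := by
  have hnonneg : 0 ≤ supAbsOn K f :=
    Real.sSup_nonneg (Set.forall_mem_image.2 fun x _ => abs_nonneg (f x))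
  rw [abs_of_nonneg hnonneg]
  exact Real.sSup_le (Set.forall_mem_image.2 h) hM

theorem supAbsOn_singleton {X : Type*} (x : X) (f : X → ℝ) : supAbsOn {x} f = |f x| := by
  simp [supAbsOn]

theorem exists_multiDeriv_const {n : ℕ} (l : List (Fin n)) (c : ℝ) :
    ∃ d : ℝ, |d| ≤ |c| ∧ multiDeriv l (fun _ => c) = fun _ => d := by
  induction l generalizing c with
  | nil => exact ⟨c, le_rfl, rfl⟩
  | cons i l ih =>
    obtain ⟨d, hd, h⟩ := ih 0
    refine ⟨d, hd.trans (by simp), ?_⟩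
    rw [← h, multiDeriv]
    congr 1
    funext x
    simp [pDeriv]

theorem abs_supAbsOn_multiDeriv_const_le {n : ℕ} (K : Set (Fin n → ℝ)) (l : List (Fin n))
    (c : ℝ) : |supAbsOn K (multiDeriv l (fun _ => c))| ≤ |c| := by
  obtain ⟨d, hd, h⟩ := exists_multiDeriv_const l c
  rw [h]
  exact abs_supAbsOn_le (abs_nonneg c) fun _ _ => hd

end Auxiliary

/-- under the total comparability assumption between `𝓑` and `𝒵`,
the ideal property implies `ℝ_M(𝓑) ⊆ ℝ_M(𝒵)` (Thm. `equivCondForIdeal`,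
(iii) + (4.1) ⇒ (i), of the paper). -/
theorem ideal_implies_RM_subset {I : Type*} [Preorder I] (S : SetOfIndices I)
    {n : ℕ} (B Z : Set (I → ℝ)) (hB : IsAG S B) (hZ : IsAG S Z)
    (Ω : Set (Fin n → ℝ)) (hΩ : IsOpen Ω) (hΩne : Ω.Nonempty)
    (htot : ∀ b ∈ B, ∀ z ∈ Z, BigO S b z ∨ BigO S z b)
    (hideal : ∀ u v : I → (Fin n → ℝ) → ℝ,
      (∀ ε, ContDiffOn ℝ (⊤ : ℕ∞) (u ε) Ω) → (∀ ε, ContDiffOn ℝ (⊤ : ℕ∞) (v ε) Ω) →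
      NNeg S Z Ω u → EMod S B Ω v → NNeg S Z Ω (fun ε x => u ε x * v ε x)) :
    RM S B ⊆ RM S Z := by
  rintro x ⟨b, hbB, hxb⟩
  by_cases hbZ : ∃ z ∈ Z, BigO S b z
  · obtain ⟨z, hz, hbz⟩ := hbZ
    exact ⟨z, hz, hxb.trans hbz⟩
  exfalso
  have hzb : ∀ z ∈ Z, BigO S z b := fun z hz =>
    (htot b hbB z hz).resolve_left fun h => hbZ ⟨z, hz, h⟩
  obtain ⟨c, hcB, hc0, hbc⟩ := hB.absAdd b hbB b hbB
  have hzc : ∀ z ∈ Z, BigO S z c := fun z hz => (hzb z hz).trans hbc.of_abs_add_abs_self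
  obtain ⟨i, hiZ, hi⟩ := hZ.infinite
  obtain ⟨s, hsZ, hs0, his⟩ := hZ.absAdd i hiZ i hiZ
  obtain ⟨p, hp⟩ := hΩne
  have hneg := hideal (fun ε _ => (c ε)⁻¹) (fun ε _ => c ε)
    (fun _ => contDiffOn_const) (fun _ => contDiffOn_const)
    (fun K _ _ l z hz =>
      BigO.trans (BigO.of_abs_le fun ε => abs_supAbsOn_multiDeriv_const_le K l (c ε)⁻¹)
        ((hzc z hz.1).inv hz.2))
    (fun K _ _ l => ⟨c, hcB,
      BigO.of_abs_le fun ε => abs_supAbsOn_multiDeriv_const_le K l (c ε)⟩)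
    {p} (Set.singleton_subset_iff.2 hp) isCompact_singleton [] s ⟨hsZ, hs0⟩
  simp only [multiDeriv, supAbsOn_singleton] at hneg
  have hone : BigO S (fun _ => 1) (fun ε => (s ε)⁻¹) :=
    BigO.trans (EventuallyExistsConst.map_mul hc0.eventuallyExistsConst
      hc0.eventuallyExistsConst fun H K _ _ ε hH hK => by
        simp [hH.1, hK.1, inv_mul_cancel₀ hH.2.ne']) hneg
  have hs1 : BigO S s (fun _ => 1) := by
    simpa using hone.inv ⟨Set.univ, S.univ_mem, fun a _ =>
      ⟨a, trivial, le_rfl, fun _ _ _ => one_pos⟩⟩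
  exact hi.not_bigO_one (his.of_abs_add_abs_self.trans hs1)
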